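/- arXiv:1408.1643 — 4 statements merged into one kernel-verified Lean document; each statement's English description precedes it below -/
import Mathlib

section
/- Let p be a prime number, Y a finitely generated abelian group, and B ⊆ Y a subgroup. Then there exists a subgroup Ȳ with B ⊆ Ȳ ⊆ Y such that the quotient Y/Ȳ is a finite p-group and the quotient Ȳ/B has no p-torsion, i.e. Ȳ/B contains no element of order p. -/
/-- For a finitely generated abelian group `Y`, a prime `p` and a subgroup `B ≤ Y`,
there is an intermediate subgroup `B ≤ C ≤ Y` with `Y/C` a finite `p`-group and
`C/B` having no element of order `p`. -/
theorem stmt_1 {p : ℕ} (hp : p.Prime) {Y : Type*} [AddCommGroup Y]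
    (hfg : AddGroup.FG Y) (B : AddSubgroup Y) :
    ∃ C : AddSubgroup Y, B ≤ C ∧
      (Finite (Y ⧸ C) ∧ ∃ n : ℕ, Nat.card (Y ⧸ C) = p ^ n) ∧
      (∀ x : ↥C ⧸ (B.addSubgroupOf C), addOrderOf x ≠ p) := by
  have hfin : Module.Finite ℤ Y := Module.Finite.iff_addGroup_fg.mpr hfg
  have hN : IsNoetherian ℤ Y := inferInstance
  let S : ℕ →o Submodule ℤ Y :=
    ⟨fun n => AddSubgroup.toIntSubmodule (B.comap (nsmulAddMonoidHom (p ^ n))), by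
      refine monotone_nat_of_le_succ fun n y hy => ?_
      change p ^ n • y ∈ B at hy
      change p ^ (n + 1) • y ∈ B
      rw [pow_succ', mul_smul]
      exact B.nsmul_mem hy p⟩
  have hS : ∀ n y, y ∈ S n ↔ p ^ n • y ∈ B := fun n y => Iff.rfl
  obtain ⟨N, hNs⟩ := monotone_stabilizes_iff_noetherian.mpr hN S
  let C : AddSubgroup Y := B ⊔ (nsmulAddMonoidHom (p ^ N) : Y →+ Y).range
  have hBC : B ≤ C := le_sup_left
  have hkill : ∀ q : Y ⧸ C, p ^ N • q = 0 := by
    intro q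
    induction q using QuotientAddGroup.induction_on with
    | H y =>
      rw [← QuotientAddGroup.mk_nsmul, QuotientAddGroup.eq_zero_iff]
      exact (le_sup_right : _ ≤ C) ⟨y, rfl⟩
  have hfinite : Finite (Y ⧸ C) := by
    haveI : AddGroup.FG (Y ⧸ C) := QuotientAddGroup.fg C
    refine AddCommGroup.finite_of_fg_isAddTorsion _ fun q => ?_
    exact isOfFinAddOrder_iff_nsmul_eq_zero.mpr ⟨p ^ N, pow_pos hp.pos N, hkill q⟩
  refine ⟨C, hBC, ⟨hfinite, ?_⟩, ?_⟩
  · haveI : Fact p.Prime := ⟨hp⟩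
    have hP : IsPGroup p (Multiplicative (Y ⧸ C)) := fun g => ⟨N, hkill g.toAdd⟩
    have hm : Finite (Multiplicative (Y ⧸ C)) := hfinite
    exact (IsPGroup.iff_card (G := Multiplicative (Y ⧸ C))).mp hP
  · intro x hx
    induction x using QuotientAddGroup.induction_on with
    | H c =>
      have h0 := addOrderOf_nsmul_eq_zero (c : ↥C ⧸ (B.addSubgroupOf C))
      rw [hx, ← QuotientAddGroup.mk_nsmul, QuotientAddGroup.eq_zero_iff,
        AddSubgroup.mem_addSubgroupOf] at h0
      obtain ⟨c, hc⟩ := c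
      obtain ⟨b, hb, _, ⟨z, rfl⟩, rfl⟩ := AddSubgroup.mem_sup.mp hc
      change p • (b + p ^ N • z) ∈ B at h0
      rw [smul_add, B.add_mem_cancel_left (B.nsmul_mem hb p), ← mul_smul, ← pow_succ',
        ← hS, ← hNs (N + 1) (Nat.le_succ N), hS] at h0
      have h1 : ((⟨b + nsmulAddMonoidHom (p ^ N) z, hc⟩ : C) : ↥C ⧸ (B.addSubgroupOf C)) = 0 := by
        rw [QuotientAddGroup.eq_zero_iff, AddSubgroup.mem_addSubgroupOf]
        exact B.add_mem hb h0
      rw [h1, addOrderOf_zero] at hx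
      exact hp.one_lt.ne hx
end

section
/- Let (X, Φ, Y, Φ̌) be a root datum and let B ⊆ Y be a submodule with Φ̌ ⊆ B. For x ∈ X write ι̌(x) ∈ Hom_ℤ(B, ℤ) for the functional b ↦ ⟨x, b⟩. Then the quadruple (Hom_ℤ(B,ℤ), ι̌(Φ), B, Φ̌) is again a root datum, called the root datum coinduced by B. Precisely: B is a finitely generated free ℤ-module; the evaluation pairing Hom_ℤ(B,ℤ) × B → ℤ is perfect; ι̌ restricts to a bijection from Φ onto ι̌(Φ); ⟨ι̌(α), α̌⟩ = 2 for every α ∈ Φ; and for all α, β ∈ Φ one has ι̌(β) − ⟨β, α̌⟩·ι̌(α) ∈ ι̌(Φ) and β̌ − ⟨α, β̌⟩·α̌ ∈ Φ̌, so the reflections attached to the pairs (ι̌(α), α̌) preserve the new sets of roots and coroots. -/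
/-- The root datum coinduced by a submodule `B ⊆ Y` containing the coroots.
Given a root datum `(X, Φ, Y, Φ̌)` (perfect pairing `P`, coroot bijection `e : Φ → Φ̌`,
`⟨α, α̌⟩ = 2`, and stability under the reflections), and a submodule `B ⊆ Y` with
`Φ̌ ⊆ B`, the quadruple `(Hom(B,ℤ), ι̌(Φ), B, Φ̌)` is again a root datum, where
`ι̌(x) = ⟨x,·⟩|_B`. -/
theorem stmt_4 {X Y : Type*} [AddCommGroup X] [AddCommGroup Y]
    [Module ℤ X] [Module ℤ Y]
    [Module.Free ℤ X] [Module.Finite ℤ X] [Module.Free ℤ Y] [Module.Finite ℤ Y]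
    (P : X →ₗ[ℤ] Y →ₗ[ℤ] ℤ)
    (hP : Function.Bijective P) (hP' : Function.Bijective P.flip)
    (Φ : Finset X) (Φv : Finset Y) (e : X → Y)
    (he : Set.BijOn e ↑Φ ↑Φv)
    (hpair : ∀ α ∈ Φ, P α (e α) = 2)
    (hrefl : ∀ α ∈ Φ, ∀ β ∈ Φ,
      (β - P β (e α) • α) ∈ Φ ∧ (e β - P α (e β) • e α) ∈ Φv)
    (B : Submodule ℤ Y) (hB : ∀ y ∈ Φv, y ∈ B) :
    -- `B` is a finitely generated free `ℤ`-module
    (Module.Free ℤ ↥B ∧ Module.Finite ℤ ↥B) ∧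
    -- the evaluation pairing `Hom(B,ℤ) × B → ℤ` is perfect
    (Function.Bijective
        (LinearMap.id : Module.Dual ℤ ↥B →ₗ[ℤ] Module.Dual ℤ ↥B) ∧
      Function.Bijective (Module.Dual.eval ℤ ↥B)) ∧
    -- `ι̌` restricts to a bijection from `Φ` onto `ι̌(Φ)`
    Set.BijOn (fun x : X => (P x).domRestrict B) ↑Φ
      ((fun x : X => (P x).domRestrict B) '' ↑Φ) ∧
    -- `⟨ι̌(α), α̌⟩ = 2` for every `α ∈ Φ`
    (∀ α : X, ∀ hα : α ∈ Φ,
      (P α).domRestrict B ⟨e α, hB (e α) (he.mapsTo hα)⟩ = 2) ∧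
    -- the reflections preserve the new roots and coroots
    (∀ α ∈ Φ, ∀ β ∈ Φ,
      ((P β).domRestrict B - P β (e α) • (P α).domRestrict B) ∈
          (fun x : X => (P x).domRestrict B) '' ↑Φ ∧
        (e β - P α (e β) • e α) ∈ Φv) := by
  rename_i iX iY _ _ _ _
  obtain rfl : iX = AddCommGroup.toIntModule X := Subsingleton.elim _ _
  obtain rfl : iY = AddCommGroup.toIntModule Y := Subsingleton.elim _ _
  have hfree : Module.Free ℤ ↥B := inferInstance
  have hfin : Module.Finite ℤ ↥B := inferInstance
  refine ⟨⟨hfree, hfin⟩, ⟨Function.bijective_id, Module.bijective_dual_eval ℤ ↥B⟩, ?_, ?_, ?_⟩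
  · refine Set.InjOn.bijOn_image ?_
    intro α hα β hβ hab
    have hα' : α ∈ Φ := hα
    have hβ' : β ∈ Φ := hβ
    have hP2 : ∀ y ∈ Φv, P α y = P β y := fun y hy =>
      congrArg (fun f : ↥B →ₗ[ℤ] ℤ => f ⟨y, hB y hy⟩) hab
    have h1 : P β (e α) = 2 := by rw [← hP2 _ (he.mapsTo hα), hpair α hα']
    have h2 : P α (e β) = 2 := by rw [hP2 _ (he.mapsTo hβ), hpair β hβ']
    have h3 := hpair α hα'
    have h4 := hpair β hβ'
    have key : ∀ k : ℕ, α + (2 * k) • (β - α) ∈ Φ := by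
      intro k
      induction k with
      | zero => simpa using hα'
      | succ k ih =>
        have a1 := (hrefl α hα' _ ih).1
        have e1 : P (α + (2 * k) • (β - α)) (e α) = 2 := by
          simp [h1, h3]
        rw [e1] at a1
        have a2 := (hrefl β hβ' _ a1).1
        have e2 : P (α + (2 * k) • (β - α) - (2 : ℤ) • α) (e β) = -2 := by
          simp [h2, h4]
        rw [e2] at a2
        convert a2 using 1
        module
    by_contra hne
    have hγ : β - α ≠ 0 := fun h => hne (sub_eq_zero.mp h).symm
    have : Module.IsTorsionFree ℤ X := inferInstance
    have hinj : Function.Injective (fun k : ℕ => α + (2 * k) • (β - α)) := by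
      intro k l hkl
      have h5 : (2 * k) • (β - α) = (2 * l) • (β - α) := add_left_cancel hkl
      have h6 : ((2 * k : ℕ) : ℤ) • (β - α) = ((2 * l : ℕ) : ℤ) • (β - α) := by
        rw [Nat.cast_smul_eq_nsmul, Nat.cast_smul_eq_nsmul]; exact h5
      have h7 := smul_left_injective ℤ hγ h6
      omega
    exact Set.infinite_of_injective_forall_mem hinj key Φ.finite_toSet
  · intro α hα
    exact hpair α hα
  · intro α hα β hβ
    refine ⟨⟨_, (hrefl α hα β hβ).1, ?_⟩, (hrefl α hα β hβ).2⟩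
    ext y
    simp
end

section
/- Let G be a group, F' : G → G a group homomorphism, and t ∈ G. Define F : G → G by F(x) = F'(t·x·t⁻¹), i.e. F = F' ∘ Inn(t), which is again a group homomorphism. Then for every integer n ≥ 1 and every x ∈ G one has Fⁿ(x) = cₙ · F'ⁿ(x) · cₙ⁻¹, where cₙ = F'(t)·F'²(t)·⋯·F'ⁿ(t); equivalently Fⁿ = Inn(cₙ) ∘ F'ⁿ, where Inn(g) denotes conjugation x ↦ g·x·g⁻¹. -/
/-- If `F = F' ∘ Inn t`, i.e. `F x = F'(t x t⁻¹)`, then for every `n ≥ 1` and `x`,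
`Fⁿ(x) = cₙ · F'ⁿ(x) · cₙ⁻¹` where `cₙ = F'(t)·F'²(t)·⋯·F'ⁿ(t)`. -/
theorem stmt_5 {G : Type*} [Group G] (F' : G →* G) (t : G)
    (F : G → G) (hF : ∀ x : G, F x = F' (t * x * t⁻¹))
    (n : ℕ) (hn : 1 ≤ n) (x : G) :
    F^[n] x =
      ((List.range n).map fun i => (⇑F')^[i + 1] t).prod * (⇑F')^[n] x *
        (((List.range n).map fun i => (⇑F')^[i + 1] t).prod)⁻¹ := by
  clear hn
  induction n generalizing x with
  | zero => simp
  | succ n ih =>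
    rw [Function.iterate_succ_apply, ih, hF, ← Function.iterate_succ_apply (⇑F') n,
      iterate_map_mul, iterate_map_mul, iterate_map_inv, List.range_succ, List.map_append,
      List.prod_append, List.map_singleton, List.prod_singleton]
    group
end

section
/- Let G be a group in which every element has finite order, and let F' : G → G be a group homomorphism such that every element of G is fixed by some positive power of F' (for each g ∈ G there exists m ≥ 1 with F'^m(g) = g). Let t ∈ G and define the group homomorphism F : G → G by F(x) = F'(t·x·t⁻¹). Then there exists an integer n ≥ 1 such that Fⁿ = F'ⁿ (equality of maps G → G). -/
/-- If every element of `G` has finite order and is fixed by some positive power of the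
homomorphism `F'`, then the twisted endomorphism `F x = F'(t x t⁻¹)` satisfies
`Fⁿ = F'ⁿ` for some `n ≥ 1`. -/
theorem stmt_6 {G : Type*} [Group G]
    (hord : ∀ g : G, ∃ m : ℕ, 1 ≤ m ∧ g ^ m = 1)
    (F' : G →* G)
    (hfix : ∀ g : G, ∃ m : ℕ, 1 ≤ m ∧ (⇑F')^[m] g = g)
    (t : G) (F : G → G) (hF : ∀ x : G, F x = F' (t * x * t⁻¹)) :
    ∃ n : ℕ, 1 ≤ n ∧ F^[n] = (⇑F')^[n] := by
  obtain ⟨m, hm, hmt⟩ := hfix t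
  have key : ∀ j : ℕ, ∃ c : G, (⇑F')^[m] c = c ∧
      ∀ x, F^[j] x = c * (⇑F')^[j] x * c⁻¹ := by
    intro j
    induction j with
    | zero => exact ⟨1, iterate_map_one F' m, fun x => by simp⟩
    | succ j ih =>
      obtain ⟨c, hc, h⟩ := ih
      refine ⟨F' (t * c), ?_, fun x => ?_⟩
      · rw [← Function.iterate_succ_apply, Function.iterate_succ_apply', iterate_map_mul, hmt, hc]
      · rw [Function.iterate_succ_apply', Function.iterate_succ_apply', h, hF]
        simp only [map_mul, map_inv, mul_inv_rev, mul_assoc]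
  obtain ⟨c, hc, h⟩ := key m
  obtain ⟨k, hk, hck⟩ := hord c
  have key2 : ∀ j : ℕ, ∀ x, (F^[m])^[j] x = c ^ j * ((⇑F')^[m])^[j] x * (c ^ j)⁻¹ := by
    intro j
    induction j with
    | zero => intro x; simp
    | succ j ih =>
      intro x
      rw [Function.iterate_succ_apply', Function.iterate_succ_apply', h, ih,
        iterate_map_mul, iterate_map_mul, iterate_map_inv, iterate_map_pow, hc, pow_succ']
      simp only [mul_inv_rev, mul_assoc]
  refine ⟨m * k, Nat.mul_pos hm hk, ?_⟩
  funext x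
  rw [Function.iterate_mul, Function.iterate_mul, key2, hck]
  simp
end
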